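/- Let 0 < m < 1 and let F:[0,∞)→ℝ be a Lipschitz, sublinear viscosity solution of the stationary equation (E) with 0 ≤ F(x) ≤ m·x for all x ≥ 0. Then there exists a constant C > 0 such that every local minimum point of F lies in the interval [0,C]. -/

import Mathlib

open Set Filter

/-- A function `ψ : [0,∞) → ℝ` is sublinear if `ψ(x)/x → 0` as `x → ∞`. -/
def Sublinear (ψ : ℝ → ℝ) : Prop :=
  Tendsto (fun x => ψ x / x) atTop (nhds 0)

/-- Viscosity subsolution of the stationary equation (E):
`(1/2)(F′ − m)(F′ − m − 1) + F/x − m = 0` on `(0,∞)`. -/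
def IsSubsolutionE (m : ℝ) (F : ℝ → ℝ) : Prop :=
  ∀ φ : ℝ → ℝ, ContDiff ℝ 1 φ →
    ∀ x₀ : ℝ, 0 < x₀ →
      IsLocalMaxOn (fun x => F x - φ x) (Ici 0) x₀ →
      (1 / 2) * (deriv φ x₀ - m) * (deriv φ x₀ - m - 1) + F x₀ / x₀ - m ≤ 0

/-- Viscosity supersolution of the stationary equation (E). -/
def IsSupersolutionE (m : ℝ) (F : ℝ → ℝ) : Prop :=
  ∀ φ : ℝ → ℝ, ContDiff ℝ 1 φ →
    ∀ x₀ : ℝ, 0 < x₀ →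
      IsLocalMinOn (fun x => F x - φ x) (Ici 0) x₀ →
      (1 / 2) * (deriv φ x₀ - m) * (deriv φ x₀ - m - 1) + F x₀ / x₀ - m ≥ 0

/-- Viscosity solution of the stationary equation (E). -/
def IsSolutionE (m : ℝ) (F : ℝ → ℝ) : Prop :=
  IsSubsolutionE m F ∧ IsSupersolutionE m F

/-- Lemma 4.1, localization of local minima.
Let `0 < m < 1` and `F` be a Lipschitz, sublinear viscosity solution of (E) with
`0 ≤ F(x) ≤ m·x`. Then there is `C > 0` such that every local minimum point of `F`
lies in `[0,C]`. -/
theorem local_minima_bounded (m : ℝ) (hm₀ : 0 < m) (hm₁ : m < 1)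
    (F : ℝ → ℝ)
    (hLip : ∃ K : NNReal, LipschitzOnWith K F (Ici 0))
    (hSub : Sublinear F)
    (hBd : ∀ x : ℝ, 0 ≤ x → 0 ≤ F x ∧ F x ≤ m * x)
    (hsol : IsSolutionE m F) :
    ∃ C > 0, ∀ x : ℝ, 0 ≤ x → IsLocalMinOn F (Ici 0) x → x ≤ C := by
  have hpos : 0 < m * (1 - m) / 2 := by
    have := mul_pos hm₀ (sub_pos.2 hm₁)
    linarith
  obtain ⟨a, ha⟩ := eventually_atTop.1 (hSub.eventually_lt_const hpos)
  refine ⟨max a 1, by positivity, fun x hx hmin => ?_⟩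
  by_contra! hlt
  have hx₀ : 0 < x := zero_lt_one.trans ((le_max_right a 1).trans_lt hlt)
  have hratio := ha x ((le_max_left a 1).trans hlt.le)
  have hsuper := hsol.2 (fun _ => 0) contDiff_const x hx₀ (by simpa using hmin)
  simp only [deriv_const] at hsuper
  nlinarith
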